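/- Let k be a field, let B be a smooth k-algebra (i.e. B is finitely presented and formally smooth over k), and let R = k[[t₁, …, t_r]] be a ring of formal power series over k in finitely many variables. Then the ring B ⊗_k R is Noetherian, and it is regular: for every prime ideal P of B ⊗_k R, the localization (B ⊗_k R)_P is a regular local ring. -/

import Mathlib

universe u

open scoped TensorProduct

/-- A Noetherian local ring is regular if its maximal ideal can be generated by
`dim`-many elements. -/
def IsRegularLocal (A : Type*) [CommRing A] [IsLocalRing A] : Prop :=
  IsNoetherianRing A ∧
    ∃ s : Finset A, Ideal.span (s : Set A) = IsLocalRing.maximalIdeal A ∧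
      (s.card : WithBot ℕ∞) = ringKrullDim A

open IsLocalRing

/-- If `R → S` , `P` over `p`, `R_p` regular, max ideal of `S_P` generated by `p`, and height ok. -/
lemma regular_of_map {R S : Type*} [CommRing R] [CommRing S] [Algebra R S]
    [IsNoetherianRing S] (p : Ideal R) [p.IsPrime] (P : Ideal S) [P.IsPrime] [P.LiesOver p]
    [IsRegularLocalRing (Localization.AtPrime p)]
    (hmap : p.map (algebraMap R (Localization.AtPrime P)) = maximalIdeal _)
    (hht : p.height ≤ P.height) : IsRegularLocalRing (Localization.AtPrime P) := by
  apply IsRegularLocalRing.of_spanFinrank_maximalIdeal_le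
  let f := Localization.localRingHom p P (algebraMap R S) (P.over_def p)
  have h1 : (maximalIdeal (Localization.AtPrime p)).map f = maximalIdeal (Localization.AtPrime P) := by
    rw [← Localization.AtPrime.map_eq_maximalIdeal, Ideal.map_map, ← hmap]
    congr 1
    ext x
    simp [f, Localization.localRingHom_to_map, IsScalarTower.algebraMap_apply R S (Localization.AtPrime P)]
  have h2 := (isRegularLocalRing_iff (Localization.AtPrime p)).mp inferInstance
  rw [IsLocalization.AtPrime.ringKrullDim_eq_height p] at h2
  rw [IsLocalization.AtPrime.ringKrullDim_eq_height P]
  refine le_trans ?_ (WithBot.coe_le_coe.mpr hht)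
  rw [← h2, Nat.cast_le, ← h1]
  have fg' := (maximalIdeal (Localization.AtPrime p)).fg_of_isNoetherianRing
  have fg := Submodule.FG.finite_generators fg'
  rw [← Submodule.FG.generators_ncard fg']
  conv_lhs => rw [← (maximalIdeal (Localization.AtPrime p)).span_generators]
  erw [Ideal.map_span]
  exact (Submodule.spanFinrank_span_le_ncard_of_finite (fg.image _)).trans (Set.ncard_image_le fg)

lemma regular_of_etale {R S : Type*} [CommRing R] [CommRing S] [Algebra R S]
    [IsRegularRing R] [Algebra.Etale R S] : IsRegularRing S := by
  have : IsNoetherianRing S := Algebra.FiniteType.isNoetherianRing R S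
  rw [isRegularRing_iff]
  intro P hP
  let p := P.under R
  have : P.LiesOver p := ⟨rfl⟩
  refine regular_of_map p P ?_ ?_
  · have hu : Algebra.IsUnramifiedAt R P := inferInstance
    let := Localization.AtPrime.algebraOfLiesOver p P
    exact ((Algebra.isUnramifiedAt_iff_map_eq R p P).mp hu).2
  · rw [Ideal.height_eq_height_add_of_liesOver_of_hasGoingDown p P]
    exact le_self_add

lemma regular_of_smooth {R S : Type u} [CommRing R] [CommRing S] [Algebra R S]
    [IsRegularRing R] [Algebra.Smooth R S] : IsRegularRing S := by
  have : IsNoetherianRing S := Algebra.FiniteType.isNoetherianRing R S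
  rw [isRegularRing_iff]
  intro P hP
  obtain ⟨s, hs, h⟩ := Algebra.Smooth.exists_span_eq_top_isStandardSmooth R S
  obtain ⟨g, hgs, hg⟩ : ∃ g ∈ s, g ∉ P := by
    by_contra! hc
    exact hP.ne_top (top_le_iff.mp (hs ▸ Ideal.span_le.mpr hc))
  have := h g hgs
  have hss : (algebraMap R (Localization.Away g)).IsStandardSmooth := by
    rwa [RingHom.isStandardSmooth_algebraMap]
  obtain ⟨n, φ, -, hφ⟩ := hss.exists_etale_mvPolynomial
  have : IsRegularRing (Localization.Away g) := by
    algebraize [φ]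
    exact regular_of_etale (R := MvPolynomial (Fin n) R)
  have disj : Disjoint (Submonoid.powers g : Set S) (P : Set S) := by
    rw [Set.disjoint_left]
    rintro _ ⟨n, rfl⟩ hx
    exact hg (hP.mem_of_pow_mem n hx)
  let Q := P.map (algebraMap S (Localization.Away g))
  have : Q.IsPrime := IsLocalization.isPrime_of_isPrime_disjoint (Submonoid.powers g) _ _ ‹_› disj
  have : IsLocalization.AtPrime (Localization.AtPrime Q) P := by
    convert IsLocalization.isLocalization_isLocalization_atPrime_isLocalization (Submonoid.powers g)
      (Localization.AtPrime Q) Q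
    exact (IsLocalization.under_map_of_isPrime_disjoint _ _ ‹_› disj).symm
  exact IsRegularLocalRing.of_ringEquiv (IsLocalization.algEquiv P.primeCompl
    (Localization.AtPrime Q) (Localization.AtPrime P)).toRingEquiv

/-- The extension of a prime ideal to the power series ring. -/
noncomputable def psExt {A : Type*} [CommRing A] (p : PrimeSpectrum A) :
    PrimeSpectrum (PowerSeries A) :=
  ⟨RingHom.ker (PowerSeries.map (Ideal.Quotient.mk p.asIdeal)), RingHom.ker_isPrime _⟩

lemma mem_psExt {A : Type*} [CommRing A] (p : PrimeSpectrum A) (f : PowerSeries A) :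
    f ∈ (psExt p).asIdeal ↔ ∀ n, PowerSeries.coeff n f ∈ p.asIdeal := by
  simp [psExt, RingHom.mem_ker, PowerSeries.ext_iff, Ideal.Quotient.eq_zero_iff_mem]

lemma psExt_strictMono {A : Type*} [CommRing A] : StrictMono (psExt (A := A)) := by
  have hle : ∀ p q : PrimeSpectrum A, p ≤ q ↔ psExt p ≤ psExt q := by
    intro p q
    constructor
    · intro h f hf
      rw [mem_psExt] at hf ⊢
      exact fun n => h (hf n)
    · intro h x hx
      have h1 : PowerSeries.C x ∈ (psExt p).asIdeal := by
        rw [mem_psExt]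
        intro n
        rw [PowerSeries.coeff_C]
        split_ifs
        · exact hx
        · exact zero_mem _
      have h2 := (mem_psExt q _).mp (h h1) 0
      simpa using h2
  intro p q h
  rw [lt_iff_le_not_ge] at h ⊢
  exact ⟨(hle _ _).mp h.1, fun h' => h.2 ((hle _ _).mpr h')⟩

lemma psExt_le {A : Type*} [CommRing A] [IsNoetherianRing A] (p : PrimeSpectrum A)
    (P : Ideal (PowerSeries A)) (h : p.asIdeal ≤ P.comap PowerSeries.C) :
    (psExt p).asIdeal ≤ P := by
  intro f hf
  rw [mem_psExt] at hf
  obtain ⟨m, s, hs⟩ := Submodule.fg_iff_exists_fin_generating_family.mp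
    (p.asIdeal.fg_of_isNoetherianRing)
  have hs' : p.asIdeal = Ideal.span (Set.range s) := hs.symm
  have h1 : ∀ n, ∃ c : Fin m → A, ∑ i, c i * s i = PowerSeries.coeff n f := by
    intro n
    have := hf n
    rw [hs'] at this
    exact Ideal.mem_span_range_iff_exists_fun.mp this
  choose c hc using h1
  have h2 : f = ∑ i, PowerSeries.mk (fun n => c n i) * PowerSeries.C (s i) := by
    ext n
    simp [PowerSeries.coeff_mul_C, hc]
  rw [h2]
  refine Ideal.sum_mem _ fun i _ => Ideal.mul_mem_left _ _ (h ?_)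
  rw [hs']
  exact Ideal.subset_span ⟨i, rfl⟩

attribute [local instance] Polynomial.algebra Polynomial.isLocalization in
open Polynomial in
lemma height_poly_le {A : Type*} [CommRing A] [IsNoetherianRing A] (p : Ideal A[X]) [hp : p.IsPrime] :
    p.height ≤ (p.comap C).height + 1 := by
  let q := p.comap C
  let B := Localization.AtPrime q
  have disj : Disjoint (q.primeCompl.map C : Set A[X]) p := by
    refine Set.disjoint_left.mpr fun a ⟨b, hb⟩ ha ↦ hb.1 ?_
    rw [SetLike.mem_coe, Ideal.mem_comap, hb.2]
    exact ha
  have h1 := IsLocalization.height_map_of_disjoint (S := B[X]) (q.primeCompl.map C) p disj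
  have hpr : (p.map (algebraMap A[X] B[X])).IsPrime :=
    IsLocalization.isPrime_of_isPrime_disjoint (q.primeCompl.map C) _ _ hp disj
  have h2 := Ideal.height_le_ringKrullDim_of_isPrime (I := p.map (algebraMap A[X] B[X]))
  rw [Polynomial.ringKrullDim_of_isNoetherianRing,
    IsLocalization.AtPrime.ringKrullDim_eq_height q] at h2
  rw [← h1]
  exact_mod_cast h2

open Polynomial in
lemma regular_weierstrass {A : Type*} [CommRing A] [IsLocalRing A] [IsRegularRing A]
    [IsAdicComplete (maximalIdeal A) A] (P : Ideal (PowerSeries A)) [hP : P.IsPrime]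
    (g : PowerSeries A) (hgP : g ∈ P) (hg : g.map (residue A) ≠ 0) :
    IsRegularLocalRing (Localization.AtPrime P) := by
  obtain ⟨F, h, hF⟩ := PowerSeries.exists_isWeierstrassFactorization hg
  have hFP : (F : PowerSeries A) ∈ P := by
    have := hF.eq_mul ▸ hgP
    rcases hP.mem_or_mem this with h1 | h1
    · exact h1
    · exact absurd (Ideal.eq_top_of_isUnit_mem _ h1 hF.isUnit) hP.ne_top
  let p := P.under A[X]
  have : P.LiesOver p := ⟨rfl⟩
  have halg : ∀ r : A[X], algebraMap A[X] (PowerSeries A) r = (r : PowerSeries A) := by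
    intro r
    simp [PowerSeries.algebraMap_apply']
  have hFp : F ∈ p := by
    rw [Ideal.mem_comap, halg]; exact hFP
  have hPp : p.map (algebraMap A[X] (PowerSeries A)) = P := by
    refine le_antisymm Ideal.map_comap_le fun x hx => ?_
    obtain ⟨c, r, hcr⟩ := PowerSeries.exists_isWeierstrassDivision x hg
    have hr : r ∈ p := by
      rw [Ideal.mem_comap, halg]
      have : (r : PowerSeries A) = x - g * c := by rw [hcr.eq_mul_add]; ring
      rw [this]
      exact P.sub_mem hx (P.mul_mem_right _ hgP)
    rw [hcr.eq_mul_add, hF.eq_mul, mul_assoc]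
    refine Ideal.add_mem _ (Ideal.mul_mem_right _ _ ?_) ?_
    · rw [← halg]; exact Ideal.mem_map_of_mem _ hFp
    · rw [← halg]; exact Ideal.mem_map_of_mem _ hr
  refine regular_of_map p P ?_ ?_
  · rw [IsScalarTower.algebraMap_eq A[X] (PowerSeries A) (Localization.AtPrime P), ← Ideal.map_map,
      hPp, Localization.AtPrime.map_eq_maximalIdeal]
  · refine (height_poly_le p).trans ?_
    let q : PrimeSpectrum A := ⟨p.comap C, inferInstance⟩
    have h1 : q.asIdeal.height ≤ (psExt q).asIdeal.height := by
      rw [PrimeSpectrum.height_eq_orderHeight, PrimeSpectrum.height_eq_orderHeight]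
      exact Order.height_le_height_apply_of_strictMono _ psExt_strictMono _
    have h2 : (psExt q).asIdeal ≤ P := by
      refine psExt_le q P fun x hx => ?_
      have hx' : algebraMap A[X] (PowerSeries A) (C x) ∈ P := hx
      rw [halg] at hx'
      simpa using hx'
    have h3 : (psExt q).asIdeal < P := by
      refine lt_of_le_of_ne h2 fun he => ?_
      rw [← he, mem_psExt] at hFP
      have := hFP F.natDegree
      rw [Polynomial.coeff_coe, Polynomial.coeff_natDegree, hF.isDistinguishedAt.monic] at this
      exact q.2.ne_top ((Ideal.eq_top_iff_one _).mpr this)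
    have := (psExt q).2
    exact (add_le_add_left h1 1).trans (Ideal.height_add_one_le_of_lt_of_isPrime h3)

lemma exists_weight (n : ℕ) : ∀ (S : Set (Fin (n + 1) → ℕ)), S.Nonempty →
    ∃ w : Fin (n + 1) → ℕ, w 0 = 1 ∧ (∀ i, w i ≠ 0) ∧ ∃ m ∈ S, ∀ d ∈ S,
      ∑ i, d i * w i = ∑ i, m i * w i → d = m := by
  induction n with
  | zero =>
    rintro S ⟨m, hm⟩
    refine ⟨fun _ => 1, rfl, by simp, m, hm, fun d _ h => ?_⟩
    ext i
    fin_cases i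
    simpa using h
  | succ n ih =>
    rintro S hS
    have hT : ((fun d : Fin (n + 2) → ℕ => d (Fin.last _)) '' S).Nonempty := hS.image _
    obtain ⟨m₀, hm₀, hc⟩ := Nat.sInf_mem hT
    have hmin : ∀ d ∈ S, m₀ (Fin.last _) ≤ d (Fin.last _) := fun d hd => by
      rw [show m₀ (Fin.last _) = _ from hc]
      exact Nat.sInf_le ⟨d, hd, rfl⟩
    obtain ⟨w, hw0, hw, m, hm, hmu⟩ := ih
      {d | (Fin.snoc d (m₀ (Fin.last _)) : Fin (n + 2) → ℕ) ∈ S}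
      ⟨Fin.init m₀, by simpa using hm₀⟩
    refine ⟨Fin.snoc w (∑ i, m i * w i + 1), ?_, ?_, _, hm, fun d hd h => ?_⟩
    · rw [← Fin.castSucc_zero, Fin.snoc_castSucc, hw0]
    · intro i
      induction i using Fin.lastCases <;> simp [hw]
    · have h1 := hmin d hd
      rw [Fin.sum_univ_castSucc (n := n + 1) (fun i => d i * _),
        Fin.sum_univ_castSucc (n := n + 1)
          (fun i => (Fin.snoc m (m₀ (Fin.last (n + 1))) : Fin (n + 2) → ℕ) i * _)] at h
      simp only [Fin.snoc_castSucc, Fin.snoc_last] at h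
      have h2 : d (Fin.last _) = m₀ (Fin.last _) := by
        by_contra hne
        have : m₀ (Fin.last _) + 1 ≤ d (Fin.last _) := by omega
        have := Nat.mul_le_mul_right (∑ i, m i * w i + 1) this
        rw [add_mul] at this
        have := Nat.zero_le (∑ i : Fin (n + 1), d i.castSucc * w i)
        omega
      rw [← Fin.snoc_init_self d, h2] at hd ⊢
      congr 1
      refine hmu _ hd ?_
      rw [h2] at h
      simpa [Fin.init] using h

open MvPowerSeries in
lemma constantCoeff_mem_span (k : Type*) [CommRing k] (n : ℕ) : ∀ f : MvPowerSeries (Fin n) k,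
    constantCoeff f = 0 → f ∈ Ideal.span (Set.range (X : Fin n → MvPowerSeries (Fin n) k)) := by
  induction n with
  | zero =>
    intro f hf
    have : f = 0 := by
      ext d
      rw [Subsingleton.elim d 0]
      simpa using hf
    simp [this]
  | succ n ih =>
    intro f hf
    let e := finSuccEquiv k n
    have h0 : constantCoeff (PowerSeries.constantCoeff (e f)) = 0 := by
      rw [← PowerSeries.coeff_zero_eq_constantCoeff_apply, ← coeff_zero_eq_constantCoeff_apply,
        coeff_coeff_finSuccEquiv, Finsupp.cons_zero_zero]
      simpa using hf
    have h1 := ih _ h0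
    obtain ⟨g, hg⟩ : PowerSeries.X ∣ e f - PowerSeries.C (PowerSeries.constantCoeff (e f)) := by
      rw [PowerSeries.X_dvd_iff]; simp
    have h2 : f = X 0 * e.symm g + e.symm (PowerSeries.C (PowerSeries.constantCoeff (e f))) := by
      apply e.injective
      simp only [map_add, map_mul, AlgEquiv.apply_symm_apply]
      rw [show e (X 0) = _ from finSuccEquiv_X_zero, ← hg]
      ring
    rw [h2]
    refine add_mem (Ideal.mul_mem_right _ _ (Ideal.subset_span ⟨0, rfl⟩)) ?_
    have h3 := Ideal.mem_map_of_mem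
      ((e.symm : _ →+* MvPowerSeries (Fin (n + 1)) k).comp (PowerSeries.C)) h1
    rw [Ideal.map_span] at h3
    refine Ideal.span_mono ?_ h3
    rintro _ ⟨_, ⟨i, rfl⟩, rfl⟩
    refine ⟨i.succ, ?_⟩
    apply e.injective
    simp [e, finSuccEquiv_X_succ]

open MvPowerSeries in
lemma maximalIdeal_mvPowerSeries (k : Type*) [Field k] (n : ℕ) :
    maximalIdeal (MvPowerSeries (Fin n) k) =
      Ideal.span (Set.range (X : Fin n → MvPowerSeries (Fin n) k)) := by
  apply le_antisymm
  · intro f hf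
    apply constantCoeff_mem_span
    rw [mem_maximalIdeal, mem_nonunits_iff, MvPowerSeries.isUnit_iff_constantCoeff] at hf
    simpa using hf
  · rw [Ideal.span_le]
    rintro _ ⟨i, rfl⟩
    rw [SetLike.mem_coe, mem_maximalIdeal, mem_nonunits_iff, MvPowerSeries.isUnit_iff_constantCoeff]
    simp

open MvPowerSeries in
noncomputable def shiftHom (k : Type*) [Field k] (n : ℕ) (a b : Fin (n + 1) → MvPowerSeries (Fin (n + 1)) k)
   (ha : HasSubst a) (hb : HasSubst b) (hab : ∀ i, subst a (b i) = X i)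
   (hba : ∀ i, subst b (a i) = X i) :
    MvPowerSeries (Fin (n + 1)) k ≃+* MvPowerSeries (Fin (n + 1)) k :=
  RingEquiv.ofRingHom (substAlgHom (R := k) ha : _ →+* _) (substAlgHom (R := k) hb : _ →+* _)
   (by
    ext1 f
    simp only [RingHom.comp_apply, RingHom.coe_coe, coe_substAlgHom, RingHom.id_apply]
    rw [subst_comp_subst_apply hb ha, funext hab, subst_self, id])
   (by
    ext1 f
    simp only [RingHom.comp_apply, RingHom.coe_coe, coe_substAlgHom, RingHom.id_apply]
    rw [subst_comp_subst_apply ha hb, funext hba, subst_self, id])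

open MvPowerSeries in
lemma exists_shift (k : Type*) [Field k] (n : ℕ) (f : MvPowerSeries (Fin (n + 1)) k) (hf : f ≠ 0) :
    ∃ σ : MvPowerSeries (Fin (n + 1)) k ≃+* MvPowerSeries (Fin (n + 1)) k,
      (finSuccEquiv k n (σ f)).map constantCoeff ≠ 0 := by
  obtain ⟨d₀, hd₀⟩ : ∃ d, coeff d f ≠ 0 := by
    by_contra! h
    exact hf (by ext d; simpa using h d)
  obtain ⟨w, hw0, hw, m, hm, hmu⟩ := exists_weight n
    {d | coeff (Finsupp.equivFunOnFinite.symm d) f ≠ 0} ⟨d₀, by simpa using hd₀⟩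
  let a (c : k) : Fin (n + 1) → MvPowerSeries (Fin (n + 1)) k :=
    fun i => if i = 0 then X 0 else X i + c • X 0 ^ w i
  have ha (c : k) : HasSubst (a c) := hasSubst_of_constantCoeff_zero fun i => by
    dsimp only [a]
    split_ifs <;> simp [hw]
  have hs (c : k) : ∀ i, subst (a c) (a (-c) i) = X i := fun i => by
    have h0 : substAlgHom (R := k) (ha c) (X 0) = X 0 := by rw [substAlgHom_X]; simp [a]
    rw [← substAlgHom_apply (ha c)]
    by_cases hi : i = 0
    · subst hi
      simpa [a] using h0
    · simp only [a, hi, if_false, map_add, map_smul, map_pow]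
      rw [h0, substAlgHom_X]
      simp [hi]
  refine ⟨shiftHom k n (a 1) (a (-1)) (ha _) (ha _) (hs 1) (by simpa using hs (-1)), ?_⟩
  let ε : MvPowerSeries (Fin (n + 1)) k →+* PowerSeries k :=
    (PowerSeries.map constantCoeff).comp (finSuccEquiv k n).toRingEquiv.toRingHom
  have hε (e : ℕ) (g) : PowerSeries.coeff e (ε g) = coeff (Finsupp.cons e 0) g := by
    simp only [ε, RingHom.comp_apply, PowerSeries.coeff_map]
    rw [← coeff_coeff_finSuccEquiv, coeff_zero_eq_constantCoeff_apply]
    rfl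
  have hεa (i) : ε (a 1 i) = PowerSeries.X ^ w i := by
    have h0 : ε (X 0) = PowerSeries.X := by simp [ε, finSuccEquiv_X_zero]
    induction i using Fin.cases with
    | zero => simp [a, h0, hw0]
    | succ i => simp [a, h0, show ε (X i.succ) = 0 by simp [ε, finSuccEquiv_X_succ]]
  intro h
  have h1 : PowerSeries.coeff (∑ i, m i * w i) (ε (subst (a 1) f)) = 0 := by
    have : ε (subst (a 1) f) = 0 := by
      rw [← h]; simp [ε, shiftHom]
    rw [this]; simp
  rw [hε, coeff_subst (ha 1), finsum_eq_single _ (Finsupp.equivFunOnFinite.symm m)] at h1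
  · rw [← hε, Finsupp.prod_fintype _ _ (by simp)] at h1
    simp only [map_prod, map_pow, hεa, ← pow_mul, Finset.prod_pow_eq_pow_sum] at h1
    rw [PowerSeries.coeff_X_pow, if_pos (by simp [mul_comm])] at h1
    exact hm (by simpa using h1)
  · intro d hd
    rw [← hε, Finsupp.prod_fintype _ _ (by simp)]
    simp only [map_prod, map_pow, hεa, ← pow_mul, Finset.prod_pow_eq_pow_sum]
    rw [PowerSeries.coeff_X_pow]
    by_cases hdf : coeff d f = 0
    · simp [hdf]
    rw [if_neg, smul_zero]
    intro he
    apply hd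
    rw [← hmu d (by simpa using hdf) (by rw [he]; simp [mul_comm])]
    simp

lemma regular_loc_of_ringEquiv {R S : Type*} [CommRing R] [CommRing S] (e : R ≃+* S)
    (P : Ideal R) [P.IsPrime] (Q : Ideal S) [Q.IsPrime] (h : P = Q.comap e)
    [IsRegularLocalRing (Localization.AtPrime Q)] : IsRegularLocalRing (Localization.AtPrime P) := by
  subst h
  exact IsRegularLocalRing.of_ringEquiv
    (IsLocalization.ringEquivOfRingEquiv (Localization.AtPrime (Q.comap e))
      (Localization.AtPrime Q) e (e.map_primeCompl_comap_eq Q)).symm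

open MvPowerSeries in
lemma regular_mvPowerSeries (k : Type*) [Field k] (n : ℕ) :
    IsRegularRing (MvPowerSeries (Fin n) k) := by
  induction n with
  | zero => exact IsRegularRing.of_ringEquiv (isEmptyEquiv (σ := Fin 0) (R := k)).symm.toRingEquiv
  | succ n ih =>
    rw [isRegularRing_iff]
    intro P hP
    by_cases eqbot : P = ⊥
    · let : Field (Localization.AtPrime P) := IsField.toField <| by
        simp [isField_iff_maximalIdeal_eq, ← Localization.AtPrime.map_eq_maximalIdeal, eqbot]
      infer_instance
    obtain ⟨f, hfP, hf⟩ := Submodule.exists_mem_ne_zero_of_ne_bot eqbot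
    obtain ⟨σ, hσ⟩ := exists_shift k n f hf
    let e := σ.trans (finSuccEquiv k n).toRingEquiv
    have : IsAdicComplete (maximalIdeal (MvPowerSeries (Fin n) k)) (MvPowerSeries (Fin n) k) := by
      rw [maximalIdeal_mvPowerSeries]
      infer_instance
    let Q := P.comap e.symm
    have hQ : IsRegularLocalRing (Localization.AtPrime Q) := by
      refine regular_weierstrass Q (e f) (by simpa [Q, Ideal.mem_comap] using hfP) fun h => hσ ?_
      ext i
      have h1 := congrArg (PowerSeries.coeff i) h
      rw [PowerSeries.coeff_map, map_zero, residue_eq_zero_iff, mem_maximalIdeal, mem_nonunits_iff,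
        MvPowerSeries.isUnit_iff_constantCoeff] at h1
      rw [PowerSeries.coeff_map, map_zero]
      simpa [e] using h1
    refine regular_loc_of_ringEquiv e P Q ?_
    ext x
    simp [Q, Ideal.mem_comap]

lemma isRegularLocal_of_isRegularLocalRing (A : Type*) [CommRing A] [IsLocalRing A]
    (h : IsRegularLocalRing A) : IsRegularLocal A := by
  refine ⟨inferInstance, ?_⟩
  have fg' := (maximalIdeal A).fg_of_isNoetherianRing
  have fg := Submodule.FG.finite_generators fg'
  refine ⟨fg.toFinset, ?_, ?_⟩
  · rw [Set.Finite.coe_toFinset]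
    exact Submodule.span_generators _
  · rw [← Set.ncard_eq_toFinset_card _ fg, Submodule.FG.generators_ncard fg']
    exact (isRegularLocalRing_iff _).mp inferInstance

/-- For a field `k`, a smooth `k`-algebra `B` and the formal power series
ring `R = k[[t₁, …, t_r]]`, the ring `B ⊗[k] R` is Noetherian and regular: all of its
localizations at primes are regular local rings. -/
theorem statement12 (k : Type u) [Field k] (B : Type u) [CommRing B] [Algebra k B]
    [Algebra.Smooth k B] (r : ℕ) :
    IsNoetherianRing (B ⊗[k] MvPowerSeries (Fin r) k) ∧
    ∀ (P : Ideal (B ⊗[k] MvPowerSeries (Fin r) k)) [P.IsPrime],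
      IsRegularLocal (Localization.AtPrime P) := by
  have := regular_mvPowerSeries k r
  have : IsRegularRing (MvPowerSeries (Fin r) k ⊗[k] B) :=
    regular_of_smooth (R := MvPowerSeries (Fin r) k)
  have h : IsRegularRing (B ⊗[k] MvPowerSeries (Fin r) k) :=
    IsRegularRing.of_ringEquiv
      (Algebra.TensorProduct.comm k (MvPowerSeries (Fin r) k) B).toRingEquiv
  exact ⟨inferInstance, fun P hP =>
    isRegularLocal_of_isRegularLocalRing _ (h.isRegularLocalRing_localization P)⟩
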